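/- If v is a non-constant word over A = {a,b} and w = a·ψ(v)·b, then ∂w = a·ψ(₊v)·b, where ₊v is the longest proper suffix of v that is immediately preceded in v by the complement of the first letter of v. -/

import Mathlib

namespace Chri

/-- Length of the longest palindromic suffix of `w`. -/
def lpsLen (w : List Bool) : ℕ :=
  ((List.range (w.length + 1)).filter
    (fun l => w.drop (w.length - l) == (w.drop (w.length - l)).reverse)).foldr max 0

/-- Right palindromic closure: the shortest palindrome having `w` as a prefix. -/
def palClosure (w : List Bool) : List Bool :=
  w ++ (w.take (w.length - lpsLen w)).reverse

/-- The iterated palindromization map ψ. -/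
def psi (v : List Bool) : List Bool :=
  v.foldl (fun w x => palClosure (w ++ [x])) []

/-- Apply a substitution (morphism of the free monoid) letter by letter. -/
def applyM (f : Bool → List Bool) (w : List Bool) : List Bool := (w.map f).flatten

/-- μ_x : x ↦ x, y ↦ xy (a = false, b = true). -/
def muL (x : Bool) : List Bool → List Bool :=
  applyM (fun y => if y = x then [x] else [x, y])

/-- λ_a = μ_a; λ_b : a ↦ ab, b ↦ b. -/
def lamL : Bool → List Bool → List Bool
  | false => applyM (fun y => if y = false then [false] else [false, true])
  | true  => applyM (fun y => if y = true then [true] else [false, true])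

/-- μ_{v₁⋯v_n} = μ_{v₁} ∘ ⋯ ∘ μ_{v_n}. -/
def muW : List Bool → List Bool → List Bool
  | [], w => w
  | x :: v, w => muL x (muW v w)

/-- λ_{v₁⋯v_n} = λ_{v₁} ∘ ⋯ ∘ λ_{v_n}. -/
def lamW : List Bool → List Bool → List Bool
  | [], w => w
  | x :: v, w => lamL x (lamW v w)

/-- Christoffel words: the letters and the words aψ(v)b. -/
def IsChristoffel (w : List Bool) : Prop :=
  w = [false] ∨ w = [true] ∨ ∃ v, w = false :: (psi v ++ [true])

/-- A word is constant if it is a power of a single letter. -/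
def IsConstant (v : List Bool) : Prop := ∃ x n, v = List.replicate n x

/-- ₊v : the longest proper suffix of v immediately preceded by the complement of
the first letter of v. -/
def plusV (v : List Bool) : List Bool :=
  (v.dropWhile (fun y => y == v.headD false)).tail

/-- v₊ : the longest proper prefix of v immediately followed by the complement of
the last letter of v. -/
def vPlus (v : List Bool) : List Bool := (plusV v.reverse).reverse

/-- α₀: the length of the first maximal block of `v` (the index). -/
def blockLen (v : List Bool) : ℕ :=
  (v.takeWhile (fun y => y == v.headD false)).length

/-- The list of lengths of the maximal blocks of equal letters of `v`
(the integral representation (α₀, …, α_n)). -/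
def blockLens : List Bool → List ℕ
  | [] => []
  | [_] => [1]
  | x :: y :: v =>
    if x = y then
      match blockLens (y :: v) with
      | [] => [1]
      | n :: ns => (n + 1) :: ns
    else 1 :: blockLens (y :: v)

/-- ext(v) = number of maximal blocks of v. -/
def ext (v : List Bool) : ℕ := (blockLens v).length

/-- π(w): the minimal period of `w` (with π(ε) = 1). -/
noncomputable def minPeriod (w : List Bool) : ℕ :=
  sInf {p | 0 < p ∧ ∀ i, i + p < w.length → w.getD i false = w.getD (i + p) false}

/-- φ_k : a ↦ a^{k+1} b, b ↦ a^k b. -/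
def phi (k : ℕ) : List Bool → List Bool :=
  applyM (fun y => if y = false then List.replicate (k + 1) false ++ [true]
                   else List.replicate k false ++ [true])

/-- φ̂_k : a ↦ a b^k, b ↦ a b^{k+1}. -/
def phiHat (k : ℕ) : List Bool → List Bool :=
  applyM (fun y => if y = false then false :: List.replicate k true
                   else false :: List.replicate (k + 1) true)

attribute [local instance] Classical.propDecidable

/-- The derivative ∂w of a proper Christoffel word w = aψ(v)b of index k:
∂(ab) = a, and otherwise the preimage of w under φ_k (if v starts with a)
or φ̂_k (if v starts with b). -/
noncomputable def derivC (w : List Bool) : List Bool :=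
  if w = [false, true] then [false]
  else if h : ∃ v, v ≠ [] ∧ w = false :: (psi v ++ [true]) then
    if h.choose.headD false = false then Function.invFun (phi (blockLen h.choose)) w
    else Function.invFun (phiHat (blockLen h.choose)) w
  else w

/-- The depth of a Christoffel word: the least d with ∂^d w a single letter. -/
noncomputable def depth (w : List Bool) : ℕ :=
  sInf {d | derivC^[d] w = [false] ∨ derivC^[d] w = [true]}

/-- The height h(v): the least n ≥ 1 such that v_(n) is constant, where
v_(1) = v and v_(n+1) = ₊(v_(n)). -/
noncomputable def height (v : List Bool) : ℕ :=
  sInf {n | 0 < n ∧ IsConstant (plusV^[n - 1] v)}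

/-- Helper computing δ_i from (α_{i-1}, δ_{i-1}) along the remaining exponents. -/
def ruleAux : ℕ → ℕ → List ℕ → List ℕ
  | _, _, [] => []
  | pa, pd, a :: rest =>
    let d := if 1 < a then 1 else if 1 < pa then 0 else 1 - pd
    d :: ruleAux a d rest

/-- The sequence δ₀, δ₁, …, δ_n computed by the recursive rule (δ₀ = 1). -/
def ruleSeq : List ℕ → List ℕ
  | [] => []
  | a :: rest => 1 :: ruleAux a 1 rest

/-- δ(v) = Σ_{i=0}^n δ_i(v), where additionally δ_n(v) = 1; δ(ε) = 1. -/
def delta (v : List Bool) : ℕ := ((ruleSeq (blockLens v)).dropLast).sum + 1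

/-- |u₁|: length of the longest prefix x₀⋯x_i of u with i < n and α₀ = ⋯ = α_i = 1
(and 0 if α₀ > 1 or n = 0). -/
def u1len (u : List Bool) : ℕ :=
  min ((blockLens u).takeWhile (fun n => n == 1)).length ((blockLens u).length - 1)

/-- |u₂|: the symmetric notion for suffixes. -/
def u2len (u : List Bool) : ℕ := u1len u.reverse

/-- The sequence H: H(1) = 0, H(2n) = H(n), H(4n±1) = H(n)+1. -/
def H : ℕ → ℕ
  | 0 => 0
  | 1 => 0
  | n + 2 =>
    if (n + 2) % 2 = 0 then H ((n + 2) / 2)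
    else if (n + 2) % 4 = 1 then H ((n + 2) / 4) + 1
    else H ((n + 3) / 4) + 1
decreasing_by all_goals omega

/-- ⟨w⟩: the word w read as an integer in base 2 (a = 0, b = 1). -/
def wordVal (w : List Bool) : ℕ :=
  w.foldl (fun acc x => 2 * acc + (if x then 1 else 0)) 0

/-- Membership in X^*: w is a concatenation of words of X. -/
def InStar (X : Set (List Bool)) (w : List Bool) : Prop :=
  ∃ l : List (List Bool), (∀ u ∈ l, u ∈ X) ∧ w = l.flatten

/-- w ∈ x⁺. -/
def PowPos (x : Bool) (w : List Bool) : Prop := ∃ k, 0 < k ∧ w = List.replicate k x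

theorem psi_append_singleton (u : List Bool) (y : Bool) :
    psi (u ++ [y]) = palClosure (psi u ++ [y]) := by
  simp [psi]

theorem applyM_nil (f : Bool → List Bool) : applyM f [] = [] := rfl

theorem applyM_cons (f : Bool → List Bool) (x : Bool) (w : List Bool) :
    applyM f (x :: w) = f x ++ applyM f w := by simp [applyM]

theorem applyM_append (f : Bool → List Bool) (u w : List Bool) :
    applyM f (u ++ w) = applyM f u ++ applyM f w := by simp [applyM]

theorem reverse_applyM (f : Bool → List Bool) (w : List Bool) :
    (applyM f w).reverse = applyM (fun y => (f y).reverse) w.reverse := by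
  induction w with
  | nil => rfl
  | cons x w ih => simp [applyM_cons, applyM_append, applyM_nil, ih]

/-- A substitution whose two images form a prefix code is injective. -/
theorem applyM_injective_of_prefix_code (f : Bool → List Bool)
    (hf : ∀ x, ¬ f x <+: f (!x)) : Function.Injective (applyM f) := by
  have hne : ∀ x, f x ≠ [] := fun x h => hf x (h ▸ List.nil_prefix)
  intro u
  induction u with
  | nil =>
    intro w h
    cases w with
    | nil => rfl
    | cons y w => simp [applyM_nil, applyM_cons, hne] at h
  | cons x u ih =>
    intro w h
    cases w with
    | nil => simp [applyM_nil, applyM_cons, hne] at h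
    | cons y w =>
      simp only [applyM_cons] at h
      by_cases hxy : y = x
      · subst hxy
        rw [ih (List.append_cancel_left h)]
      · have hy : y = !x := by cases x <;> cases y <;> simp_all
        subst hy
        exfalso
        rcases List.prefix_or_prefix_of_prefix
          (List.prefix_append (f x) (applyM f u)) (h ▸ List.prefix_append (f !x) _) with h1 | h1
        · exact hf x h1
        · exact hf (!x) (by simpa using h1)

/-- A substitution whose two images form a suffix code is injective. -/
theorem applyM_injective_of_suffix_code (f : Bool → List Bool)
    (hf : ∀ x, ¬ f x <:+ f (!x)) : Function.Injective (applyM f) := by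
  intro u w h
  have h1 := congrArg List.reverse h
  rw [reverse_applyM, reverse_applyM] at h1
  exact List.reverse_injective (applyM_injective_of_prefix_code _
    (fun x hx => hf x (List.reverse_prefix.1 hx)) h1)

theorem muL_injective (x : Bool) : Function.Injective (muL x) := by
  refine applyM_injective_of_suffix_code _ fun y => ?_
  cases x <;> cases y <;> decide

theorem phi_injective (k : ℕ) : Function.Injective (phi k) := by
  refine applyM_injective_of_prefix_code _ fun y => ?_
  cases y
  · intro h
    simpa using h.length_le
  · simp [List.replicate_succ', List.prefix_append_right_inj]

theorem phiHat_injective (k : ℕ) : Function.Injective (phiHat k) := by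
  refine applyM_injective_of_suffix_code _ fun y => ?_
  cases y
  · rintro ⟨l, h⟩
    have h1 : (l ++ [false]) ++ List.replicate k true = [false, true] ++ List.replicate k true := by
      simpa [List.replicate_succ] using h
    simpa using congrArg List.getLast? (List.append_cancel_right h1)
  · intro h
    simpa using h.length_le

/-- `t` is the longest palindromic suffix of `r ++ t`. -/
def IsLongestPalSuffix (r t : List Bool) : Prop :=
  t.reverse = t ∧ ∀ r' t', r ++ t = r' ++ t' → t'.reverse = t' → t'.length ≤ t.length

theorem foldr_max_le_iff (l : List ℕ) (m : ℕ) : l.foldr max 0 ≤ m ↔ ∀ a ∈ l, a ≤ m := by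
  induction l with
  | nil => simp
  | cons a l ih => simp [ih]

theorem foldr_max_mem (l : List ℕ) (hl : l ≠ []) : l.foldr max 0 ∈ l := by
  induction l with
  | nil => exact absurd rfl hl
  | cons a l ih =>
    by_cases h : l = []
    · simp [h]
    · have := ih h
      rw [List.foldr_cons]
      rcases max_choice a (l.foldr max 0) with h1 | h1 <;> rw [h1] <;> simp [this]

theorem isLongestPalSuffix_lpsLen (s : List Bool) :
    IsLongestPalSuffix (s.take (s.length - lpsLen s)) (s.drop (s.length - lpsLen s)) := by
  have hmem : lpsLen s ∈ (List.range (s.length + 1)).filter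
      (fun l => s.drop (s.length - l) == (s.drop (s.length - l)).reverse) := by
    apply foldr_max_mem
    apply List.ne_nil_of_mem (a := 0)
    simp
  rw [List.mem_filter, List.mem_range] at hmem
  obtain ⟨h1, h2⟩ := hmem
  refine ⟨(eq_of_beq h2).symm, ?_⟩
  intro r' t' h ht
  rw [List.take_append_drop] at h
  have : t'.length ≤ lpsLen s := by
    apply (foldr_max_le_iff _ _).1 le_rfl
    rw [List.mem_filter, List.mem_range]
    subst h
    simp [ht]
  simp
  omega

theorem palClosure_eq {r t : List Bool} (h : IsLongestPalSuffix r t) :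
    palClosure (r ++ t) = r ++ t ++ r.reverse := by
  have h' := isLongestPalSuffix_lpsLen (r ++ t)
  have h1 := h.2 _ _ (List.take_append_drop ((r ++ t).length - lpsLen (r ++ t)) _).symm h'.1
  have h2 := h'.2 r t (List.take_append_drop _ _) h.1
  have h3 : (r ++ t).length - lpsLen (r ++ t) = r.length := by
    simp only [List.length_drop, List.length_append] at h1 h2 ⊢
    omega
  rw [palClosure, h3, List.take_left]

theorem exists_isLongestPalSuffix (s : List Bool) :
    ∃ r t, s = r ++ t ∧ IsLongestPalSuffix r t :=
  ⟨_, _, (List.take_append_drop _ _).symm, isLongestPalSuffix_lpsLen s⟩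

theorem muL_nil (x : Bool) : muL x [] = [] := rfl

theorem muL_append (x : Bool) (u w : List Bool) : muL x (u ++ w) = muL x u ++ muL x w :=
  applyM_append _ u w

theorem muL_singleton_self (x : Bool) : muL x [x] = [x] := by simp [muL, applyM]

theorem muL_singleton_not (x : Bool) : muL x [!x] = [x, !x] := by simp [muL, applyM]

theorem muL_cons (x y : Bool) (u : List Bool) : muL x (y :: u) = muL x [y] ++ muL x u :=
  muL_append x [y] u

theorem cons_reverse_muL (x : Bool) (w : List Bool) :
    x :: (muL x w).reverse = muL x w.reverse ++ [x] := by
  induction w with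
  | nil => rfl
  | cons y w ih =>
    rw [muL_cons, List.reverse_append, ← List.cons_append, ih, List.reverse_cons, muL_append]
    rcases Bool.eq_or_eq_not y x with rfl | rfl
    · simp [muL_singleton_self]
    · simp [muL_singleton_not]

theorem reverse_muL_append (x : Bool) (w : List Bool) :
    (muL x w ++ [x]).reverse = muL x w.reverse ++ [x] := by
  simp [← cons_reverse_muL]

/-- A suffix of `muL x z ++ [x]` starting with `x` begins at the boundary of a block. -/
theorem exists_of_muL_append_eq (x : Bool) (z : List Bool) :
    ∀ r t, muL x z ++ [x] = r ++ x :: t →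
      ∃ z₁ z₂, z = z₁ ++ z₂ ∧ x :: t = muL x z₂ ++ [x] := by
  induction z with
  | nil =>
    intro r t h
    have hr : r = [] := by
      have := congrArg List.length h
      simp [muL_nil] at this
      exact List.length_eq_zero_iff.1 (by omega)
    subst hr
    exact ⟨[], [], rfl, h.symm⟩
  | cons y z ih =>
    intro r t h
    cases r with
    | nil => exact ⟨[], y :: z, rfl, h.symm⟩
    | cons c r =>
      suffices ∃ r', muL x z ++ [x] = r' ++ x :: t by
        obtain ⟨r', h'⟩ := this
        obtain ⟨z₁, z₂, rfl, h2⟩ := ih r' t h'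
        exact ⟨y :: z₁, z₂, rfl, h2⟩
      rw [muL_cons] at h
      rcases Bool.eq_or_eq_not y x with rfl | rfl
      · rw [muL_singleton_self] at h
        exact ⟨r, by simpa using (List.cons.inj h).2⟩
      · rw [muL_singleton_not] at h
        have h1 := (List.cons.inj h).2
        cases r with
        | nil => simp at h1
        | cons d r => exact ⟨r, by simpa using (List.cons.inj h1).2⟩

theorem IsLongestPalSuffix.muL {r t : List Bool} (x : Bool) (h : IsLongestPalSuffix r t) :
    IsLongestPalSuffix (muL x r) (muL x t ++ [x]) := by
  refine ⟨by rw [reverse_muL_append, h.1], ?_⟩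
  intro r' t' he ht
  cases t' with
  | nil => simp
  | cons c t' =>
    have hc : c = x := by
      have h1 := congrArg List.getLast? he
      rw [← ht] at h1
      simpa using h1.symm
    subst hc
    rw [← List.append_assoc, ← muL_append] at he
    obtain ⟨z₁, z₂, hz, h2⟩ := exists_of_muL_append_eq c _ _ _ he
    rw [h2]
    have hz2 : z₂.reverse = z₂ := by
      rw [h2, reverse_muL_append] at ht
      exact muL_injective c (List.append_cancel_right ht)
    have hlen := h.2 _ _ hz hz2
    have hsuf : z₂ <:+ t :=
      List.suffix_of_suffix_length_le ⟨z₁, hz.symm⟩ ⟨r, rfl⟩ hlen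
    obtain ⟨q, rfl⟩ := hsuf
    simp [muL_append]

theorem palClosure_muL_append (x : Bool) (z : List Bool) :
    palClosure (muL x z ++ [x]) = muL x (palClosure z) ++ [x] := by
  obtain ⟨r, t, rfl, h⟩ := exists_isLongestPalSuffix z
  rw [palClosure_eq h, muL_append, List.append_assoc, palClosure_eq (h.muL x)]
  simp [muL_append, ← cons_reverse_muL]

/-- In the image of `muL x`, every letter other than `x` is preceded by `x`. -/
theorem exists_of_muL_eq_append_not (x : Bool) (z : List Bool) :
    ∀ r t, muL x z = r ++ (!x) :: t → ∃ r₀, r = r₀ ++ [x] := by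
  induction z with
  | nil =>
    intro r t h
    simp [muL_nil] at h
  | cons y z ih =>
    intro r t h
    rw [muL_cons] at h
    rcases Bool.eq_or_eq_not y x with rfl | rfl
    · rw [muL_singleton_self] at h
      cases r with
      | nil => simp at h
      | cons c r =>
        obtain ⟨r₀, rfl⟩ := ih r t (List.cons.inj h).2
        exact ⟨c :: r₀, rfl⟩
    · rw [muL_singleton_not] at h
      match r with
      | [] => simp at h
      | [c] => exact ⟨[], by simpa using (List.cons.inj h).1.symm⟩
      | c :: d :: r =>
        obtain ⟨r₀, rfl⟩ := ih r t (List.cons.inj (List.cons.inj h).2).2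
        exact ⟨c :: d :: r₀, rfl⟩

/-- Appending the letter `x` forced by the coding does not change the closure. -/
theorem palClosure_muL_append_not (x : Bool) (u : List Bool) :
    palClosure (muL x (u ++ [!x])) = palClosure (muL x (u ++ [!x]) ++ [x]) := by
  obtain ⟨r, t, he, h⟩ := exists_isLongestPalSuffix (muL x (u ++ [!x]))
  have hu : muL x (u ++ [!x]) = muL x u ++ [x, !x] := by rw [muL_append, muL_singleton_not]
  have hpos := h.2 (muL x u ++ [x]) [!x] (by rw [← he, hu]; simp) rfl
  obtain ⟨c, t, rfl⟩ := List.exists_cons_of_length_pos hpos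
  obtain rfl : c = !x := by
    have h1 := congrArg List.getLast? he
    rw [hu, ← h.1] at h1
    simpa using h1.symm
  obtain ⟨r₀, rfl⟩ := exists_of_muL_eq_append_not x _ _ _ he
  have hx : IsLongestPalSuffix r₀ (x :: ((!x) :: t) ++ [x]) := by
    refine ⟨by rw [List.reverse_append, List.reverse_cons (a := x) (as := _ :: _), h.1]; rfl,
      fun r' t' he' ht' => ?_⟩
    match t', t'.eq_nil_or_concat with
    | [], _ => simp
    | [_], _ => simp
    | d :: e :: m, hm =>
      obtain ⟨m', f, hm⟩ := hm.resolve_left (by simp)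
      cases m' with
      | nil => simp at hm
      | cons d' m' =>
        rw [List.concat_cons, List.concat_eq_append, List.cons.injEq] at hm
        rw [hm.2] at he' ht' ⊢
        have hpal : m'.reverse = m' := by
          simp only [List.reverse_cons, List.reverse_append, List.reverse_nil, List.nil_append,
            List.cons_append, List.cons.injEq] at ht'
          exact List.append_inj_left' ht'.2 rfl
        have h2 : r₀ ++ [x] ++ (!x) :: t = (r' ++ [d]) ++ m' := by
          have h3 : (r₀ ++ [x] ++ (!x) :: t) ++ [x] = ((r' ++ [d]) ++ m') ++ [f] := by
            simpa using he'
          exact List.append_inj_left' h3 rfl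
        have h4 := h.2 _ _ h2 hpal
        simp only [List.length_append, List.length_cons, List.length_nil] at h4 ⊢
        omega
  have h5 := palClosure_eq hx
  rw [he, palClosure_eq h]
  simp only [List.append_assoc, List.cons_append, List.nil_append, List.reverse_append,
    List.reverse_cons, List.reverse_nil] at h5 ⊢
  rw [h5]

theorem psi_cons (x : Bool) (u : List Bool) : psi (x :: u) = muL x (psi u) ++ [x] := by
  induction u using List.reverseRecOn with
  | nil =>
    have h : IsLongestPalSuffix [] [x] := by
      refine ⟨rfl, fun r' t' h _ => ?_⟩
      rw [List.nil_append] at h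
      simp [h]
    simpa [psi, muL_nil] using palClosure_eq h
  | append_singleton u y ih =>
    rw [← List.cons_append, psi_append_singleton, ih, psi_append_singleton]
    rcases Bool.eq_or_eq_not y x with rfl | rfl
    · rw [← palClosure_muL_append, muL_append, muL_singleton_self]
    · rw [← palClosure_muL_append, ← palClosure_muL_append_not, muL_append, muL_singleton_not]
      simp

theorem psi_injective : Function.Injective psi := by
  intro u
  induction u with
  | nil =>
    intro w h
    cases w with
    | nil => rfl
    | cons y w => simp [psi_cons] at h; simp [psi] at h
  | cons x u ih =>
    intro w h
    cases w with
    | nil => simp [psi_cons] at h; simp [psi] at h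
    | cons y w =>
      rw [psi_cons, psi_cons] at h
      obtain ⟨h1, h2⟩ := List.append_inj' h rfl
      obtain rfl : x = y := by simpa using h2
      rw [ih (muL_injective x h1)]

theorem psi_replicate_append (x : Bool) (k : ℕ) (u : List Bool) :
    psi (List.replicate k x ++ u) = (muL x)^[k] (psi u) ++ List.replicate k x := by
  induction k with
  | zero => simp
  | succ k ih =>
    have hk : muL x (List.replicate k x) = List.replicate k x := by
      clear ih
      induction k with
      | zero => rfl
      | succ k ih => rw [List.replicate_succ, muL_cons, ih, muL_singleton_self]; rfl
    rw [List.replicate_succ, List.cons_append, psi_cons, ih, muL_append, hk,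
      Function.iterate_succ_apply', List.append_assoc, ← List.replicate_succ', List.replicate_succ]

theorem iterate_muL_append (x : Bool) (k : ℕ) (u w : List Bool) :
    (muL x)^[k] (u ++ w) = (muL x)^[k] u ++ (muL x)^[k] w := by
  induction k with
  | zero => rfl
  | succ k ih => simp only [Function.iterate_succ_apply', ih, muL_append]

theorem iterate_muL_nil (x : Bool) (k : ℕ) : (muL x)^[k] [] = [] :=
  Function.iterate_fixed (muL_nil x) k

theorem iterate_muL_singleton_self (x : Bool) (k : ℕ) : (muL x)^[k] [x] = [x] := by
  induction k with
  | zero => rfl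
  | succ k ih => rw [Function.iterate_succ_apply', ih, muL_singleton_self]

theorem iterate_muL_singleton_not (x : Bool) (k : ℕ) :
    (muL x)^[k] [!x] = List.replicate k x ++ [!x] := by
  induction k with
  | zero => rfl
  | succ k ih =>
    rw [Function.iterate_succ_apply, muL_singleton_not, ← List.singleton_append,
      iterate_muL_append, iterate_muL_singleton_self, ih]
    rfl

theorem iterate_muL_muL_singleton (x : Bool) (k : ℕ) :
    (muL x)^[k] (muL (!x) [x]) = List.replicate k x ++ [!x, x] := by
  have h : muL (!x) [x] = [!x] ++ [x] := by simpa using muL_singleton_not (!x)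
  rw [h, iterate_muL_append, iterate_muL_singleton_not, iterate_muL_singleton_self]
  simp

theorem psi_block (x : Bool) (k : ℕ) (u : List Bool) :
    psi (List.replicate k x ++ (!x) :: u) =
      (muL x)^[k] (muL (!x) (psi u)) ++ List.replicate k x ++ [!x] ++ List.replicate k x := by
  rw [psi_replicate_append, psi_cons, iterate_muL_append, iterate_muL_singleton_not]
  simp

theorem append_phi (k : ℕ) (z : List Bool) :
    List.replicate k false ++ [true] ++ phi k z =
      (muL false)^[k] (muL true z) ++ List.replicate k false ++ [true] := by
  have hs := iterate_muL_muL_singleton false k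
  have hn := iterate_muL_singleton_not false k
  rw [Bool.not_false] at hs hn
  induction z with
  | nil => simp [phi, applyM_nil, muL_nil, iterate_muL_nil]
  | cons y z ih =>
    have hc : (muL false)^[k] (muL true (y :: z)) ++ List.replicate k false ++ [true] =
        (muL false)^[k] (muL true [y]) ++ (List.replicate k false ++ [true] ++ phi k z) := by
      rw [ih, muL_cons, iterate_muL_append]
      simp
    rw [hc, phi, applyM_cons, ← phi]
    cases y
    · rw [hs]
      simp [List.replicate_succ]
    · rw [muL_singleton_self, hn]
      simp

theorem append_phiHat (k : ℕ) (z : List Bool) :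
    List.replicate k true ++ phiHat k z =
      (muL true)^[k] (muL false z) ++ List.replicate k true := by
  have hs := iterate_muL_muL_singleton true k
  have hn := iterate_muL_singleton_not true k
  rw [Bool.not_true] at hs hn
  induction z with
  | nil => simp [phiHat, applyM_nil, muL_nil, iterate_muL_nil]
  | cons y z ih =>
    rw [muL_cons, iterate_muL_append, List.append_assoc, ← ih, phiHat, applyM_cons, ← phiHat]
    cases y
    · rw [muL_singleton_self, hn]
      simp
    · rw [hs]
      simp [List.replicate_succ]

theorem phi_christoffel (k : ℕ) (u : List Bool) :
    phi k (false :: (psi u ++ [true])) =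
      false :: (psi (List.replicate k false ++ true :: u) ++ [true]) := by
  have h := psi_block false k u
  rw [Bool.not_false, ← append_phi] at h
  rw [h]
  simp [phi, applyM_cons, applyM_append, applyM_nil, List.replicate_succ]

theorem phiHat_christoffel (k : ℕ) (u : List Bool) :
    phiHat k (false :: (psi u ++ [true])) =
      false :: (psi (List.replicate k true ++ false :: u) ++ [true]) := by
  have h := psi_block true k u
  rw [Bool.not_true, ← append_phiHat] at h
  rw [h]
  simp [phiHat, applyM_cons, applyM_append, applyM_nil, List.replicate_succ']

theorem exists_block_of_not_isConstant {v : List Bool} (hv : ¬ IsConstant v) :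
    ∃ x k u, v = List.replicate (k + 1) x ++ (!x) :: u := by
  induction v with
  | nil => exact absurd ⟨false, 0, rfl⟩ hv
  | cons y v ih =>
    by_cases h : IsConstant v
    · obtain ⟨x, n, rfl⟩ := h
      cases n with
      | zero => exact absurd ⟨y, 1, rfl⟩ hv
      | succ n =>
        rcases Bool.eq_or_eq_not x y with rfl | rfl
        · exact absurd ⟨x, n + 2, rfl⟩ hv
        · exact ⟨y, 0, List.replicate n (!y), rfl⟩
    · obtain ⟨x, k, u, rfl⟩ := ih h
      rcases Bool.eq_or_eq_not x y with rfl | rfl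
      · exact ⟨x, k + 1, u, rfl⟩
      · exact ⟨y, 0, List.replicate k (!y) ++ (!(!y)) :: u, by simp [List.replicate_succ]⟩

theorem headD_block (x : Bool) (k : ℕ) (u : List Bool) :
    (List.replicate (k + 1) x ++ (!x) :: u).headD false = x := rfl

theorem blockLen_block (x : Bool) (k : ℕ) (u : List Bool) :
    blockLen (List.replicate (k + 1) x ++ (!x) :: u) = k + 1 := by
  rw [blockLen, headD_block, List.takeWhile_append_of_pos (by simp)]
  simp

theorem plusV_block (x : Bool) (k : ℕ) (u : List Bool) :
    plusV (List.replicate (k + 1) x ++ (!x) :: u) = u := by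
  rw [plusV, headD_block, List.dropWhile_append_of_pos (by simp)]
  simp

theorem derivC_eq {v : List Bool} (hv : v ≠ []) :
    derivC (false :: (psi v ++ [true])) =
      if v.headD false = false then
        Function.invFun (phi (blockLen v)) (false :: (psi v ++ [true]))
      else Function.invFun (phiHat (blockLen v)) (false :: (psi v ++ [true])) := by
  have hne : false :: (psi v ++ [true]) ≠ [false, true] := by
    intro h
    apply hv
    apply psi_injective
    simpa [psi] using h
  have hex : ∃ v', v' ≠ [] ∧ false :: (psi v ++ [true]) = false :: (psi v' ++ [true]) :=
    ⟨v, hv, rfl⟩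
  have hch : hex.choose = v := by
    have h := hex.choose_spec.2
    exact psi_injective (List.append_cancel_right (List.cons.inj h).2).symm
  rw [derivC, if_neg hne, dif_pos hex, hch]

/-- if v is non-constant and w = a·ψ(v)·b, then ∂w = a·ψ(₊v)·b. -/
theorem deriv_christoffel (v w : List Bool) (hv : ¬ IsConstant v)
    (hw : w = false :: (psi v ++ [true])) :
    derivC w = false :: (psi (plusV v) ++ [true]) := by
  obtain ⟨x, k, u, rfl⟩ := exists_block_of_not_isConstant hv
  subst hw
  rw [derivC_eq (by simp), headD_block, blockLen_block, plusV_block]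
  cases x
  · rw [if_pos rfl, Bool.not_false, ← phi_christoffel]
    exact Function.leftInverse_invFun (phi_injective _) _
  · rw [if_neg (by simp), Bool.not_true, ← phiHat_christoffel]
    exact Function.leftInverse_invFun (phiHat_injective _) _

end Chri
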